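/- Let (S_j)_{j=0}^{N-1} be a representation of the Cuntz algebra 𝒪_N on H, let (σ_i)_{i=0}^{N-1} be a complete and non-overlapping iterated function system on a compact metric space X, let f ∈ H with ‖f‖ = 1, and let μ_f be a spectral measure of f. Then there exists a linear isometry V : L²(X, μ_f) → H such that V(1) = f, such that for every multi-index i = (i_1,…,i_k) and every ψ ∈ L²(μ_f) one has V(χ_{A_k(i)} · ψ) = S_{i_1}⋯S_{i_k}S_{i_k}^*⋯S_{i_1}^* (V ψ), where χ_{A_k(i)} is the indicator function of A_k(i), and such that the range of V equals the closed linear span of {S_i S_i^* f : i a multi-index} ∪ {f}. -/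

import Mathlib

open MeasureTheory ContinuousLinearMap
open scoped InnerProductSpace

variable {H : Type*} [NormedAddCommGroup H] [InnerProductSpace ℂ H] [CompleteSpace H]
variable {X : Type*} [MetricSpace X] [CompactSpace X] [MeasurableSpace X] [BorelSpace X]

/-- The word operator `S_α = S_{α 1} ⋯ S_{α k}` associated to a multi-index
`α ∈ {0,…,N-1}^k`. -/
noncomputable def Sw {N : ℕ} (S : Fin N → H →L[ℂ] H) {k : ℕ} (α : Fin k → Fin N) :
    H →L[ℂ] H :=
  (List.ofFn fun i => S (α i)).prod

/-- A family `S_0, …, S_{N-1}` of bounded operators is a representation of the Cuntz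
algebra `𝒪_N` if `S_j^* S_k = δ_{jk} I` and `∑ j, S_j S_j^* = I`. -/
def CuntzRep {N : ℕ} (S : Fin N → H →L[ℂ] H) : Prop :=
  (∀ j k : Fin N, adjoint (S j) ∘L S k = if j = k then 1 else 0) ∧
    ∑ j : Fin N, S j ∘L adjoint (S j) = 1

/-- The composition `σ_{i_1} ∘ ⋯ ∘ σ_{i_k}` for a multi-index `i`. -/
def compIFS {N : ℕ} (σ : Fin N → X → X) {k : ℕ} (i : Fin k → Fin N) : X → X :=
  (List.ofFn fun j => σ (i j)).foldr (· ∘ ·) id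

/-- `A_k(i) = σ_{i_1} ∘ ⋯ ∘ σ_{i_k}(X)`. -/
def Ak {N : ℕ} (σ : Fin N → X → X) {k : ℕ} (i : Fin k → Fin N) : Set X :=
  Set.range (compIFS σ i)

/-- The IFS is complete if the diameters of `A_k(i_1,…,i_k)` tend to `0` along every
infinite word `(i_1, i_2, …)`. -/
def CompleteIFS {N : ℕ} (σ : Fin N → X → X) : Prop :=
  ∀ s : ℕ → Fin N,
    Filter.Tendsto (fun k : ℕ => Metric.diam (Ak σ fun j : Fin k => s j))
      Filter.atTop (nhds 0)

/-- The IFS is non-overlapping if for each `k` the sets `A_k(i)` are pairwise disjoint. -/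
def NonOverlapping {N : ℕ} (σ : Fin N → X → X) : Prop :=
  ∀ k : ℕ, ∀ i i' : Fin k → Fin N, i ≠ i' → Disjoint (Ak σ i) (Ak σ i')

/-- A Borel measure `μ` on `X` is a spectral measure of `g` if `μ(X) = ‖g‖²`
and `μ(A_k(i)) = ‖S_i^* g‖²` for every `k ≥ 1` and multi-index `i`. -/
def IsSpectralMeasureX {N : ℕ} (S : Fin N → H →L[ℂ] H) (σ : Fin N → X → X) (g : H)
    (μ : Measure X) : Prop :=
  μ Set.univ = ENNReal.ofReal (‖g‖ ^ 2) ∧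
    ∀ k : ℕ, 1 ≤ k → ∀ i : Fin k → Fin N,
      μ (Ak σ i) = ENNReal.ofReal (‖adjoint (Sw S i) g‖ ^ 2)

section Isometry

variable {E F ι : Type*} [NormedAddCommGroup E] [InnerProductSpace ℂ E]
  [NormedAddCommGroup F] [InnerProductSpace ℂ F]

theorem norm_linearCombination_eq_of_inner_eq {u : ι → E} {v : ι → F}
    (h : ∀ a b, ⟪u a, u b⟫_ℂ = ⟪v a, v b⟫_ℂ) (c : ι →₀ ℂ) :
    ‖Finsupp.linearCombination ℂ v c‖ = ‖Finsupp.linearCombination ℂ u c‖ := by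
  have key : ⟪Finsupp.linearCombination ℂ v c, Finsupp.linearCombination ℂ v c⟫_ℂ =
      ⟪Finsupp.linearCombination ℂ u c, Finsupp.linearCombination ℂ u c⟫_ℂ := by
    simp only [Finsupp.linearCombination_apply, Finsupp.sum, sum_inner, inner_sum,
      inner_smul_left, inner_smul_right, h]
  rw [inner_self_eq_norm_sq_to_K, inner_self_eq_norm_sq_to_K] at key
  have key' : ‖Finsupp.linearCombination ℂ v c‖ ^ 2 = ‖Finsupp.linearCombination ℂ u c‖ ^ 2 := by
    exact_mod_cast key
  exact (sq_eq_sq₀ (norm_nonneg _) (norm_nonneg _)).mp key'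

/-- Two families with the same Gram matrix, the first of them total, are related by a linear
isometry. -/
theorem exists_linearIsometry_of_inner_eq [CompleteSpace F] {u : ι → E} {v : ι → F}
    (hu : (Submodule.span ℂ (Set.range u)).topologicalClosure = ⊤)
    (h : ∀ a b, ⟪u a, u b⟫_ℂ = ⟪v a, v b⟫_ℂ) :
    ∃ V : E →ₗᵢ[ℂ] F, ∀ a, V (u a) = v a := by
  set e := Finsupp.linearCombination ℂ u
  set g := Finsupp.linearCombination ℂ v
  have hnorm : ∀ c, ‖g c‖ = ‖e c‖ := norm_linearCombination_eq_of_inner_eq h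
  have hd : DenseRange e := by
    rw [DenseRange, ← LinearMap.coe_range, Finsupp.range_linearCombination]
    exact Submodule.dense_iff_topologicalClosure_eq_top.mpr hu
  have heq : ∀ c, g.extendOfNorm e (e c) = g c :=
    LinearMap.extendOfNorm_eq hd ⟨1, fun c => by rw [hnorm, one_mul]⟩
  refine ⟨⟨(g.extendOfNorm e).toLinearMap, fun x => ?_⟩, fun a => ?_⟩
  · refine hd.induction (P := fun x => ‖g.extendOfNorm e x‖ = ‖x‖) ?_
      (isClosed_eq (by fun_prop) (by fun_prop)) x
    rintro _ ⟨c, rfl⟩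
    rw [heq, hnorm]
  · simpa [e, g] using heq (Finsupp.single a 1)

end Isometry

/-- The operator `S_{l_1} ⋯ S_{l_k}` of a word `l`. -/
noncomputable def wordOp {N : ℕ} (S : Fin N → H →L[ℂ] H) (l : List (Fin N)) : H →L[ℂ] H :=
  (l.map S).prod

/-- The projection `S_l S_l^*` of a word `l`. -/
noncomputable def wordProj {N : ℕ} (S : Fin N → H →L[ℂ] H) (l : List (Fin N)) : H →L[ℂ] H :=
  wordOp S l ∘L adjoint (wordOp S l)

/-- The set `σ_{l_1} ∘ ⋯ ∘ σ_{l_k}(X)` of a word `l`. -/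
def wordSet {X : Type*} {N : ℕ} (σ : Fin N → X → X) (l : List (Fin N)) : Set X :=
  Set.range ((l.map σ).foldr (· ∘ ·) id)

section Words

variable {N : ℕ}

omit [CompleteSpace H] in
theorem Sw_eq_wordOp (S : Fin N → H →L[ℂ] H) {k : ℕ} (α : Fin k → Fin N) :
    Sw S α = wordOp S (List.ofFn α) := by
  simp [Sw, wordOp, List.map_ofFn, Function.comp_def]

theorem Ak_eq_wordSet {X : Type*} (σ : Fin N → X → X) {k : ℕ} (α : Fin k → Fin N) :
    Ak σ α = wordSet σ (List.ofFn α) := by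
  simp [Ak, compIFS, wordSet, List.map_ofFn, Function.comp_def]

theorem word_trichotomy {A : Type*} (l m : List A) :
    l <+: m ∨ m <+: l ∨
      ∃ l' m' : List A, l' <+: l ∧ m' <+: m ∧ l'.length = m'.length ∧ l' ≠ m' := by
  by_cases h : l.take m.length = m.take l.length
  · rcases le_total l.length m.length with hlm | hlm
    · left
      rw [List.take_of_length_le hlm] at h
      exact h ▸ List.take_prefix _ _
    · right; left
      rw [List.take_of_length_le hlm] at h
      exact h ▸ List.take_prefix _ _
  · exact Or.inr (Or.inr ⟨_, _, List.take_prefix _ _, List.take_prefix _ _, by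
      simp [min_comm], h⟩)

end Words

section Sets

variable {X : Type*} {N : ℕ} (σ : Fin N → X → X)

@[simp]
theorem wordSet_nil : wordSet σ [] = Set.univ := by
  simp [wordSet]

theorem wordSet_append_subset (l m : List (Fin N)) : wordSet σ (l ++ m) ⊆ wordSet σ l := by
  have key : ((l ++ m).map σ).foldr (· ∘ ·) id =
      (l.map σ).foldr (· ∘ ·) id ∘ (m.map σ).foldr (· ∘ ·) id := by
    induction l with
    | nil => rfl
    | cons a l ih => simpa [Function.comp_assoc] using congrArg (σ a ∘ ·) ih
  rw [wordSet, key]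
  exact Set.range_comp_subset_range _ _

theorem wordSet_subset_of_prefix {l m : List (Fin N)} (h : l <+: m) :
    wordSet σ m ⊆ wordSet σ l := by
  obtain ⟨t, rfl⟩ := h
  exact wordSet_append_subset σ l t

theorem measurableSet_wordSet [MetricSpace X] [CompactSpace X] [MeasurableSpace X] [BorelSpace X]
    {σ : Fin N → X → X} (hσ : ∀ i, Continuous (σ i)) (l : List (Fin N)) :
    MeasurableSet (wordSet σ l) := by
  have : Continuous ((l.map σ).foldr (· ∘ ·) id) := by
    induction l with
    | nil => exact continuous_id
    | cons a l ih => exact (hσ a).comp ih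
  exact (isCompact_range this).isClosed.measurableSet

theorem disjoint_wordSet_of_length_eq {σ : Fin N → X → X}
    (h : NonOverlapping σ) {l m : List (Fin N)} (hlm : l.length = m.length) (hne : l ≠ m) :
    Disjoint (wordSet σ l) (wordSet σ m) := by
  obtain ⟨k, hk⟩ : ∃ k, k = m.length := ⟨_, rfl⟩
  obtain ⟨α, rfl⟩ : ∃ α : Fin k → Fin N, List.ofFn α = l := by
    subst hk; exact ⟨fun i => l.get (i.cast hlm.symm), by
      apply List.ext_get <;> simp [hlm]⟩
  obtain ⟨β, rfl⟩ : ∃ β : Fin k → Fin N, List.ofFn β = m := by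
    subst hk; exact ⟨m.get, List.ofFn_get m⟩
  rw [← Ak_eq_wordSet, ← Ak_eq_wordSet]
  exact h k α β fun hαβ => hne (hαβ ▸ rfl)

end Sets

section Operators

variable {N : ℕ} {S : Fin N → H →L[ℂ] H}

omit [CompleteSpace H] in
theorem wordOp_cons (a : Fin N) (l : List (Fin N)) : wordOp S (a :: l) = S a ∘L wordOp S l := rfl

omit [CompleteSpace H] in
theorem wordOp_append (l m : List (Fin N)) :
    wordOp S (l ++ m) = wordOp S l ∘L wordOp S m := by
  rw [wordOp, List.map_append, List.prod_append]; rfl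

@[simp]
theorem wordProj_nil_apply (x : H) : wordProj S [] x = x := by
  have : adjoint (1 : H →L[ℂ] H) = 1 := star_one _
  simp [wordProj, wordOp, this]

theorem CuntzRep.adjoint_apply (hS : CuntzRep S) (j k : Fin N) (x : H) :
    adjoint (S j) (S k x) = if j = k then x else 0 := by
  have := congrArg (fun T : H →L[ℂ] H => T x) (hS.1 j k)
  split_ifs with h <;> simpa [h] using this

theorem CuntzRep.adjoint_wordOp_apply_self (hS : CuntzRep S) (l : List (Fin N)) (x : H) :
    adjoint (wordOp S l) (wordOp S l x) = x := by
  induction l with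
  | nil => simpa [wordProj, wordOp] using wordProj_nil_apply (S := S) x
  | cons a l ih => simp [wordOp_cons, adjoint_comp, hS.adjoint_apply, ih]

theorem CuntzRep.adjoint_wordOp_apply_of_ne (hS : CuntzRep S) {l m : List (Fin N)}
    (hlm : l.length = m.length) (hne : l ≠ m) (x : H) :
    adjoint (wordOp S l) (wordOp S m x) = 0 := by
  induction l generalizing m with
  | nil => exact absurd (List.length_eq_zero_iff.mp hlm.symm).symm hne
  | cons a l ih =>
    cases m with
    | nil => simp at hlm
    | cons b m =>
      rw [wordOp_cons, wordOp_cons, adjoint_comp]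
      by_cases hab : a = b
      · subst hab
        simpa [hS.adjoint_apply] using
          ih (by simpa using hlm) fun h => hne (h ▸ rfl)
      · simp [hS.adjoint_apply, hab]

theorem CuntzRep.sum_norm_sq_adjoint (hS : CuntzRep S) (x : H) :
    ∑ j, ‖adjoint (S j) x‖ ^ 2 = ‖x‖ ^ 2 := by
  have h := congrArg (fun T : H →L[ℂ] H => ⟪x, T x⟫_ℂ) hS.2
  simp only [sum_apply, comp_apply, inner_sum, one_apply_eq_self,
    ← adjoint_inner_left, inner_self_eq_norm_sq_to_K] at h
  exact_mod_cast h

theorem inner_wordProj_left (l : List (Fin N)) (x y : H) :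
    ⟪wordProj S l x, y⟫_ℂ = ⟪x, wordProj S l y⟫_ℂ := by
  rw [wordProj, comp_apply, comp_apply, ← adjoint_inner_right, adjoint_inner_left]

theorem CuntzRep.wordProj_of_prefix (hS : CuntzRep S) {l m : List (Fin N)} (h : l <+: m) (x : H) :
    wordProj S l (wordProj S m x) = wordProj S m x := by
  obtain ⟨t, rfl⟩ := h
  simp [wordProj, wordOp_append, hS.adjoint_wordOp_apply_self]

theorem CuntzRep.wordProj_of_prefix' (hS : CuntzRep S) {l m : List (Fin N)} (h : l <+: m) (x : H) :
    wordProj S m (wordProj S l x) = wordProj S m x := by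
  obtain ⟨t, rfl⟩ := h
  simp [wordProj, wordOp_append, adjoint_comp, hS.adjoint_wordOp_apply_self]

theorem CuntzRep.wordProj_of_length_eq (hS : CuntzRep S) {l m : List (Fin N)}
    (hlm : l.length = m.length) (hne : l ≠ m) (x : H) :
    wordProj S l (wordProj S m x) = 0 := by
  simp [wordProj, hS.adjoint_wordOp_apply_of_ne hlm hne]

omit [MetricSpace X] [CompactSpace X] [MeasurableSpace X] [BorelSpace X] in
/-- Two words either are nested, or have disjoint sets and orthogonal projections. -/
theorem CuntzRep.wordProj_wordSet_cases (hS : CuntzRep S) {σ : Fin N → X → X}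
    (hσ : NonOverlapping σ) (l m : List (Fin N)) :
    (∃ n, wordSet σ l ∩ wordSet σ m = wordSet σ n ∧
      ∀ x, wordProj S l (wordProj S m x) = wordProj S n x) ∨
    (wordSet σ l ∩ wordSet σ m = ∅ ∧ ∀ x, wordProj S l (wordProj S m x) = 0) := by
  rcases word_trichotomy l m with h | h | ⟨l', m', hl, hm, hlen, hne⟩
  · exact Or.inl ⟨m, Set.inter_eq_right.mpr (wordSet_subset_of_prefix σ h),
      hS.wordProj_of_prefix h⟩
  · exact Or.inl ⟨l, Set.inter_eq_left.mpr (wordSet_subset_of_prefix σ h),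
      hS.wordProj_of_prefix' h⟩
  · refine Or.inr ⟨((disjoint_wordSet_of_length_eq hσ hlen hne).mono
      (wordSet_subset_of_prefix σ hl) (wordSet_subset_of_prefix σ hm)).inter_eq, fun x => ?_⟩
    rw [← hS.wordProj_of_prefix' hl, ← hS.wordProj_of_prefix hm,
      hS.wordProj_of_length_eq hlen hne, map_zero]

end Operators

section Spectral

variable {N : ℕ} {S : Fin N → H →L[ℂ] H} {σ : Fin N → X → X} {f : H} {μ : Measure X}

omit [MetricSpace X] [CompactSpace X] [BorelSpace X] in
theorem IsSpectralMeasureX.measure_wordSet (hμ : IsSpectralMeasureX S σ f μ) (l : List (Fin N)) :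
    μ (wordSet σ l) = ENNReal.ofReal (‖adjoint (wordOp S l) f‖ ^ 2) := by
  rcases Nat.eq_zero_or_pos l.length with h | h
  · have h1 : adjoint (1 : H →L[ℂ] H) = 1 := star_one _
    rw [List.length_eq_zero_iff.mp h, wordSet_nil, hμ.1]
    simp [wordOp, h1]
  · simpa [Ak_eq_wordSet, Sw_eq_wordOp, List.ofFn_get] using hμ.2 l.length h l.get

omit [MetricSpace X] [CompactSpace X] [BorelSpace X] in
theorem IsSpectralMeasureX.isFiniteMeasure (hμ : IsSpectralMeasureX S σ f μ) :
    IsFiniteMeasure μ :=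
  ⟨hμ.1 ▸ ENNReal.ofReal_lt_top⟩

theorem inner_wordProj_self (l : List (Fin N)) (x : H) :
    ⟪x, wordProj S l x⟫_ℂ = ((‖adjoint (wordOp S l) x‖ ^ 2 : ℝ) : ℂ) := by
  rw [wordProj, comp_apply, ← adjoint_inner_left, inner_self_eq_norm_sq_to_K]
  simp

/-- Almost every point of `wordSet σ l` lies in one of the next-level sets. -/
theorem IsSpectralMeasureX.ae_exists_mem_wordSet_append (hμ : IsSpectralMeasureX S σ f μ)
    (hS : CuntzRep S) (hcont : ∀ i, Continuous (σ i)) (hno : NonOverlapping σ) :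
    ∀ᵐ x ∂μ, ∀ l : List (Fin N), x ∈ wordSet σ l → ∃ j, x ∈ wordSet σ (l ++ [j]) := by
  have := hμ.isFiniteMeasure
  rw [ae_all_iff]
  intro l
  have hmeas : ∀ m, MeasurableSet (wordSet σ m) := measurableSet_wordSet hcont
  have hsum : μ (⋃ j, wordSet σ (l ++ [j])) = μ (wordSet σ l) := by
    rw [measure_iUnion _ fun j => hmeas _, tsum_fintype]
    · simp only [hμ.measure_wordSet]
      rw [← ENNReal.ofReal_sum_of_nonneg fun _ _ => by positivity,
        ← hS.sum_norm_sq_adjoint (adjoint (wordOp S l) f)]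
      have hsingle : ∀ j, wordOp S [j] = S j := fun j => by simp [wordOp]
      simp only [wordOp_append, hsingle, adjoint_comp, comp_apply]
    · intro i j hij
      exact disjoint_wordSet_of_length_eq hno (by simp) (by simpa using hij)
  have hae := ae_eq_of_subset_of_measure_ge
    (Set.iUnion_subset fun j => wordSet_append_subset σ l [j]) hsum.ge
    (MeasurableSet.iUnion fun j => hmeas _).nullMeasurableSet (measure_ne_top μ _)
  filter_upwards [hae.mem_iff] with x hx hxl
  simpa using hx.mpr hxl

/-- Almost every point has arbitrarily small sets `wordSet σ l` around it. -/
theorem IsSpectralMeasureX.ae_exists_wordSet_subset (hμ : IsSpectralMeasureX S σ f μ)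
    (hS : CuntzRep S) (hcont : ∀ i, Continuous (σ i)) (hcomp : CompleteIFS σ)
    (hno : NonOverlapping σ) :
    ∀ᵐ x ∂μ, ∀ U : Set X, IsOpen U → x ∈ U → ∃ l, x ∈ wordSet σ l ∧ wordSet σ l ⊆ U := by
  filter_upwards [hμ.ae_exists_mem_wordSet_append hS hcont hno] with x hx U hU hxU
  have : Nonempty (Fin N) := (hx [] (by simp)).nonempty
  choose! j hj using hx
  let L : ℕ → List (Fin N) := fun n => n.rec [] fun _ l => l ++ [j l]
  have hL : ∀ n, x ∈ wordSet σ (L n) := by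
    intro n
    induction n with
    | zero => simp [L]
    | succ n ih => exact hj _ ih
  have hLs : ∀ n, List.ofFn (fun i : Fin n => j (L i)) = L n := by
    intro n
    induction n with
    | zero => rfl
    | succ n ih => rw [List.ofFn_succ_last]; exact congrArg (· ++ [j (L n)]) ih
  obtain ⟨ε, hε, hball⟩ := Metric.isOpen_iff.mp hU x hxU
  obtain ⟨n, hn⟩ := ((hcomp fun i => j (L i)).eventually (gt_mem_nhds hε)).exists
  rw [Ak_eq_wordSet, hLs] at hn
  refine ⟨L n, hL n, fun y hy => hball ?_⟩
  exact (Metric.dist_le_diam_of_mem (Metric.isBounded_of_compactSpace) hy (hL n)).trans_lt hn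

/-- The indicator function of `wordSet σ l` as an element of `L²(μ)`. -/
noncomputable def wordIndicator [IsFiniteMeasure μ] (hcont : ∀ i, Continuous (σ i))
    (l : List (Fin N)) : Lp ℂ 2 μ :=
  indicatorConstLp 2 (measurableSet_wordSet hcont l) (measure_ne_top μ _) 1

theorem IsSpectralMeasureX.ae_eq_zero_of_setIntegral_wordSet (hμ : IsSpectralMeasureX S σ f μ)
    (hS : CuntzRep S) (hcont : ∀ i, Continuous (σ i)) (hcomp : CompleteIFS σ)
    (hno : NonOverlapping σ) {ψ : X → ℂ} (hψ : Integrable ψ μ)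
    (h : ∀ l, ∫ x in wordSet σ l, ψ x ∂μ = 0) : ψ =ᵐ[μ] 0 := by
  have hmeas : ∀ m, MeasurableSet (wordSet σ m) := measurableSet_wordSet hcont
  have huniv : ∫ x, ψ x ∂μ = 0 := by simpa using h []
  have hcompl : ∀ t, MeasurableSet t → ∫ x in t, ψ x ∂μ = 0 → ∫ x in tᶜ, ψ x ∂μ = 0 := by
    intro t ht h0
    rw [setIntegral_compl ht hψ, h0, huniv, sub_zero]
  have hUnion : ∀ s : ℕ → Set X, Pairwise (Function.onFun Disjoint s) →
      (∀ i, MeasurableSet (s i)) → (∀ i, ∫ x in s i, ψ x ∂μ = 0) →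
      ∫ x in ⋃ i, s i, ψ x ∂μ = 0 := by
    intro s hd hm h0
    rw [integral_iUnion hm hd hψ.integrableOn]
    simp [h0]
  have hgen_le : MeasurableSpace.generateFrom (Set.range (wordSet σ)) ≤ ‹MeasurableSpace X› :=
    MeasurableSpace.generateFrom_le (by rintro _ ⟨l, rfl⟩; exact hmeas l)
  have hpi : IsPiSystem (Set.range (wordSet σ)) := by
    rintro _ ⟨l, rfl⟩ _ ⟨m, rfl⟩ hne
    rcases hS.wordProj_wordSet_cases hno l m with ⟨n, hn, -⟩ | ⟨h0, -⟩
    · exact ⟨n, hn.symm⟩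
    · exact absurd h0 hne.ne_empty
  have hgen : ∀ t, MeasurableSet[MeasurableSpace.generateFrom (Set.range (wordSet σ))] t →
      ∫ x in t, ψ x ∂μ = 0 := by
    intro t ht
    induction t, ht using MeasurableSpace.induction_on_inter rfl hpi with
    | empty => simp
    | basic t ht => obtain ⟨l, rfl⟩ := ht; exact h l
    | compl t ht ih => exact hcompl t (hgen_le t ht) ih
    | iUnion s hd hm ih => exact hUnion s hd (fun i => hgen_le _ (hm i)) ih
  have hopen : ∀ U, IsOpen U → ∫ x in U, ψ x ∂μ = 0 := by
    intro U hU
    have hae : U =ᵐ[μ] (⋃ l ∈ {l | wordSet σ l ⊆ U}, wordSet σ l : Set X) := by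
      rw [Filter.eventuallyEq_set]
      filter_upwards [hμ.ae_exists_wordSet_subset hS hcont hcomp hno] with x hx
      simp only [Set.mem_iUnion, exists_prop]
      exact ⟨fun hxU => (hx U hU hxU).imp fun _ h => h.symm, fun ⟨l, hl, hxl⟩ => hl hxl⟩
    rw [setIntegral_congr_set hae]
    exact hgen _ (MeasurableSet.biUnion (Set.to_countable _) fun l _ =>
      MeasurableSpace.measurableSet_generateFrom ⟨l, rfl⟩)
  refine hψ.ae_eq_zero_of_forall_setIntegral_eq_zero fun s hs hlt => ?_
  clear hlt
  have hborel : ‹MeasurableSpace X› = MeasurableSpace.generateFrom {s | IsOpen s} :=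
    BorelSpace.measurable_eq
  induction s, hs using MeasurableSpace.induction_on_inter hborel isPiSystem_isOpen with
  | empty => simp
  | basic t ht => exact hopen t (by simpa using ht)
  | compl t ht ih => exact hcompl t ht ih
  | iUnion s hd hm ih => exact hUnion s hd hm ih

theorem IsSpectralMeasureX.span_wordIndicator [IsFiniteMeasure μ]
    (hμ : IsSpectralMeasureX S σ f μ) (hS : CuntzRep S) (hcont : ∀ i, Continuous (σ i))
    (hcomp : CompleteIFS σ) (hno : NonOverlapping σ) :
    (Submodule.span ℂ (Set.range (wordIndicator (μ := μ) hcont))).topologicalClosure = ⊤ := by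
  rw [Submodule.topologicalClosure_eq_top_iff, Submodule.eq_bot_iff]
  intro ψ hψ
  refine (Lp.eq_zero_iff_ae_eq_zero).mpr
    (hμ.ae_eq_zero_of_setIntegral_wordSet hS hcont hcomp hno
      ((Lp.memLp ψ).integrable (by norm_num)) fun l => ?_)
  rw [← L2.inner_indicatorConstLp_one (𝕜 := ℂ) (measurableSet_wordSet hcont l)
    (measure_ne_top μ _) ψ]
  exact (Submodule.mem_orthogonal _ _).mp hψ _ (Submodule.subset_span ⟨l, rfl⟩)

theorem IsSpectralMeasureX.inner_wordIndicator [IsFiniteMeasure μ]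
    (hμ : IsSpectralMeasureX S σ f μ) (hS : CuntzRep S) (hcont : ∀ i, Continuous (σ i))
    (hno : NonOverlapping σ) (l m : List (Fin N)) :
    ⟪wordIndicator (μ := μ) hcont l, wordIndicator hcont m⟫_ℂ =
      ⟪wordProj S l f, wordProj S m f⟫_ℂ := by
  have hL : ⟪wordIndicator (μ := μ) hcont l, wordIndicator hcont m⟫_ℂ =
      (μ.real (wordSet σ l ∩ wordSet σ m) : ℂ) := by
    simp [wordIndicator, L2.inner_indicatorConstLp_indicatorConstLp]
  rw [hL, inner_wordProj_left]
  rcases hS.wordProj_wordSet_cases hno l m with ⟨n, hn, hP⟩ | ⟨h0, hP⟩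
  · rw [hn, hP, inner_wordProj_self, measureReal_def, hμ.measure_wordSet,
      ENNReal.toReal_ofReal (by positivity)]
  · simp [h0, hP]

/-- An isometry sending indicators to the vectors `S_l S_l^* f` intertwines multiplication by
indicators with the projections `S_l S_l^*`. -/
theorem CuntzRep.map_indicator_mul [IsFiniteMeasure μ] (hS : CuntzRep S)
    (hcont : ∀ i, Continuous (σ i)) (hno : NonOverlapping σ)
    (hspan : (Submodule.span ℂ
      (Set.range (wordIndicator (μ := μ) hcont))).topologicalClosure = ⊤)
    (V : Lp ℂ 2 μ →L[ℂ] H) (hV : ∀ l, V (wordIndicator hcont l) = wordProj S l f)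
    (l : List (Fin N)) {ψ g : Lp ℂ 2 μ}
    (hg : (g : X → ℂ) =ᵐ[μ]
      fun x => (wordSet σ l).indicator (fun _ => (1 : ℂ)) x * (ψ : X → ℂ) x) :
    V g = wordProj S l (V ψ) := by
  let χ : Lp ℂ ⊤ μ :=
    indicatorConstLp ⊤ (measurableSet_wordSet hcont l) (measure_ne_top μ _) 1
  let M : Lp ℂ 2 μ →L[ℂ] Lp ℂ 2 μ := (ContinuousLinearMap.mul ℂ ℂ).holderL μ ⊤ 2 2 χ
  have hM : ∀ φ : Lp ℂ 2 μ, M φ =ᵐ[μ]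
      fun x => (wordSet σ l).indicator (fun _ => (1 : ℂ)) x * (φ : X → ℂ) x := by
    intro φ
    filter_upwards [(ContinuousLinearMap.mul ℂ ℂ).coeFn_holder (r := 2) χ φ,
      indicatorConstLp_coeFn (p := ⊤) (hs := measurableSet_wordSet hcont l)
        (hμs := measure_ne_top μ _) (c := (1 : ℂ))] with x hx hχ
    rw [← hχ]
    exact hx
  have hgM : g = M ψ := Lp.ext (hg.trans (hM ψ).symm)
  have hMm : ∀ m, V (M (wordIndicator hcont m)) = wordProj S l (wordProj S m f) := by
    intro m
    have hprod : M (wordIndicator hcont m) =ᵐ[μ]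
        (wordSet σ l ∩ wordSet σ m).indicator fun _ => (1 : ℂ) := by
      filter_upwards [hM (wordIndicator hcont m), indicatorConstLp_coeFn (p := 2)
        (hs := measurableSet_wordSet hcont m) (hμs := measure_ne_top μ _) (c := (1 : ℂ))]
        with x hx hm
      rw [hx, wordIndicator, hm, ← Set.indicator_mul_left]
      simp [Set.indicator_indicator]
    rcases hS.wordProj_wordSet_cases hno l m with ⟨n, hn, hP⟩ | ⟨h0, hP⟩
    · rw [hP, ← hV]
      congr 1
      refine Lp.ext (hprod.trans ?_)
      rw [hn]
      exact indicatorConstLp_coeFn.symm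
    · rw [hP, ← map_zero V]
      congr 1
      refine Lp.ext (hprod.trans ?_)
      rw [h0, Set.indicator_empty]
      exact (Lp.coeFn_zero _ _ _).symm
  have hext : V ∘L M = wordProj S l ∘L V := by
    refine ContinuousLinearMap.ext_on
      (Submodule.dense_iff_topologicalClosure_eq_top.mpr hspan) ?_
    rintro _ ⟨m, rfl⟩
    simp [hMm, hV]
  rw [hgM]
  exact congrArg (fun T : Lp ℂ 2 μ →L[ℂ] H => T ψ) hext

end Spectral

theorem LinearIsometry.range_eq_closure_span {E F ι : Type*} [NormedAddCommGroup E]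
    [NormedSpace ℂ E] [CompleteSpace E] [NormedAddCommGroup F] [NormedSpace ℂ F]
    (V : E →ₗᵢ[ℂ] F) {u : ι → E}
    (hu : (Submodule.span ℂ (Set.range u)).topologicalClosure = ⊤) :
    Set.range V = closure (Submodule.span ℂ (Set.range (V ∘ u)) : Set F) := by
  have hspan : (Submodule.span ℂ (Set.range (V ∘ u)) : Set F) =
      V '' (Submodule.span ℂ (Set.range u)) := by
    rw [Set.range_comp, ← LinearIsometry.coe_toLinearMap, ← Submodule.map_coe,
      Submodule.map_span]
  rw [hspan, V.isometry.isClosedEmbedding.closure_image_eq,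
    (Submodule.dense_iff_topologicalClosure_eq_top.mpr hu).closure_eq, Set.image_univ]

theorem range_wordProj_apply {N : ℕ} (S : Fin N → H →L[ℂ] H) (f : H) :
    (Set.range fun l => wordProj S l f) =
      insert f {x : H | ∃ k : ℕ, 1 ≤ k ∧ ∃ i : Fin k → Fin N,
        x = (Sw S i) (adjoint (Sw S i) f)} := by
  ext x
  simp only [Set.mem_range, Set.mem_insert_iff, Set.mem_ofPred_eq, Sw_eq_wordOp]
  constructor
  · rintro ⟨l, rfl⟩
    rcases Nat.eq_zero_or_pos l.length with h | h
    · exact Or.inl (by rw [List.length_eq_zero_iff.mp h, wordProj_nil_apply])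
    · exact Or.inr ⟨l.length, h, l.get, by rw [List.ofFn_get]; rfl⟩
  · rintro (rfl | ⟨k, -, i, rfl⟩)
    · exact ⟨[], wordProj_nil_apply _⟩
    · exact ⟨List.ofFn i, rfl⟩

/-- Given a spectral measure `μ` of a unit vector `f`, there is an isometry
`V : L²(X, μ) → H` with `V 1 = f`, intertwining multiplication by `χ_{A_k(i)}` with the
projection `S_i S_i^*`, and with range the closed span of `{S_i S_i^* f} ∪ {f}`. -/
theorem stmt_4 {N : ℕ} (hN : 2 ≤ N) (S : Fin N → H →L[ℂ] H) (hS : CuntzRep S)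
    (σ : Fin N → X → X) (hcont : ∀ i, Continuous (σ i))
    (hcomp : CompleteIFS σ) (hno : NonOverlapping σ)
    (f : H) (hf : ‖f‖ = 1) (μ : Measure X) (hμ : IsSpectralMeasureX S σ f μ) :
    ∃ V : Lp ℂ 2 μ →ₗᵢ[ℂ] H,
      (∀ g : Lp ℂ 2 μ, (g : X → ℂ) =ᵐ[μ] (fun _ => (1 : ℂ)) → V g = f) ∧
      (∀ k : ℕ, 1 ≤ k → ∀ i : Fin k → Fin N, ∀ ψ g : Lp ℂ 2 μ,
        (g : X → ℂ) =ᵐ[μ]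
            (fun x => (Ak σ i).indicator (fun _ => (1 : ℂ)) x * (ψ : X → ℂ) x) →
          V g = (Sw S i ∘L adjoint (Sw S i)) (V ψ)) ∧
      Set.range V = closure ((Submodule.span ℂ
        (insert f {x : H | ∃ k : ℕ, 1 ≤ k ∧ ∃ i : Fin k → Fin N,
          x = (Sw S i) (adjoint (Sw S i) f)}) : Submodule ℂ H) : Set H) := by
  have := hμ.isFiniteMeasure
  have hspan := hμ.span_wordIndicator hS hcont hcomp hno
  obtain ⟨V, hV⟩ := exists_linearIsometry_of_inner_eq (v := fun l => wordProj S l f) hspan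
    (hμ.inner_wordIndicator hS hcont hno)
  refine ⟨V, fun g hg => ?_, fun k _ i ψ g hg => ?_, ?_⟩
  · have hg1 : g = wordIndicator hcont [] := by
      refine Lp.ext (hg.trans ?_)
      filter_upwards [indicatorConstLp_coeFn (p := 2) (hs := measurableSet_wordSet hcont [])
        (hμs := measure_ne_top μ _) (c := (1 : ℂ))] with x hx
      rw [wordIndicator, hx]
      simp
    rw [hg1, hV, wordProj_nil_apply]
  · rw [Ak_eq_wordSet] at hg
    rw [Sw_eq_wordOp]
    exact hS.map_indicator_mul hcont hno hspan V.toContinuousLinearMap hV _ hg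
  · rw [V.range_eq_closure_span hspan, ← range_wordProj_apply]
    simp only [Function.comp_def, hV]
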